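/- Let d ≥ 1, 𝐤 ∈ ℕ_{>0}^d, 1 ≤ l < l', and let 𝒮^𝐤_j = {𝐚 ∈ ℕ^d : 𝐚 ≼ 𝐤, 1 ≤ |𝐚| ≤ j}. For any subset 𝒜 ⊆ 𝒮^𝐤_{l'}, the real rank of the matrix (𝐚^𝐢)_{𝐚∈𝒜, 𝐢∈𝒮^𝐤_l} (with entries 𝐚^𝐢 = a₁^{i₁}⋯a_d^{i_d}) is at least (|𝒮^𝐤_l| / |𝒮^𝐤_{l'}|) · |𝒜|. -/

import Mathlib

open Finset

/-- The sum of `f` over the points of the box `Iic k` whose coordinates add up to `t`. -/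
noncomputable def layerSum {d : ℕ} (k : Fin d → ℕ) (f : (Fin d → ℕ) → ℝ) (t : ℤ) : ℝ :=
  ∑ a ∈ Iic k, if (∑ i, (a i : ℤ)) = t then f a else 0

/-- The average of `f` over a layer of the box `Iic k`, extended constantly to negative levels. -/
noncomputable def layerMean {d : ℕ} (k : Fin d → ℕ) (f : (Fin d → ℕ) → ℝ) (t : ℤ) : ℝ :=
  layerSum k f (max t 0) / layerSum k 1 (max t 0)

/-- Log-concavity without internal zeros of a sequence indexed by the integers. -/
def IsLogConcaveSeq (w : ℤ → ℝ) : Prop :=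
  ∀ (p q : ℤ) (n : ℕ), p ≤ q → w p * w (q + n) ≤ w (p + n) * w q

lemma layerSum_succ {d : ℕ} (k : Fin (d + 1) → ℕ) (f : (Fin (d + 1) → ℕ) → ℝ) (t : ℤ) :
    layerSum k f t = ∑ x ∈ range (k 0 + 1),
      layerSum (Fin.tail k) (fun b => f (Fin.cons x b)) (t - x) := by
  simp only [layerSum]
  rw [← Finset.sum_product']
  refine Finset.sum_bij' (fun a _ => (a 0, Fin.tail a)) (fun p _ => Fin.cons p.1 p.2) ?_ ?_ ?_ ?_ ?_
  · intro a ha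
    rw [mem_Iic] at ha
    simp only [mem_product, mem_range, mem_Iic]
    exact ⟨Nat.lt_succ_of_le (ha 0), fun i => ha i.succ⟩
  · rintro ⟨x, b⟩ h
    simp only [mem_product, mem_range, mem_Iic] at h ⊢
    intro i
    refine Fin.cases ?_ (fun j => ?_) i
    · simpa using Nat.le_of_lt_succ h.1
    · exact h.2 j
  · intro a _
    exact Fin.cons_self_tail a
  · rintro ⟨x, b⟩ _
    simp
  · intro a _
    simp only [Fin.cons_self_tail, Fin.sum_univ_succ, Fin.tail]
    refine if_congr ?_ rfl rfl
    constructor <;> intro h <;> linarith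

lemma layerSum_mono {d : ℕ} (k : Fin d → ℕ) {f g : (Fin d → ℕ) → ℝ} (h : f ≤ g) (t : ℤ) :
    layerSum k f t ≤ layerSum k g t := by
  refine Finset.sum_le_sum fun a _ => ?_
  split_ifs
  · exact h a
  · exact le_rfl

lemma layerSum_nonneg {d : ℕ} (k : Fin d → ℕ) {f : (Fin d → ℕ) → ℝ} (h : 0 ≤ f) (t : ℤ) :
    0 ≤ layerSum k f t := by
  simpa [layerSum] using layerSum_mono k h t

lemma layerSum_one_nonneg {d : ℕ} (k : Fin d → ℕ) (t : ℤ) : 0 ≤ layerSum k 1 t :=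
  layerSum_nonneg k zero_le_one t

lemma layerSum_of_neg {d : ℕ} (k : Fin d → ℕ) (f : (Fin d → ℕ) → ℝ) {t : ℤ} (ht : t < 0) :
    layerSum k f t = 0 := by
  refine Finset.sum_eq_zero fun a _ => if_neg ?_
  have : 0 ≤ ∑ i, (a i : ℤ) := Finset.sum_nonneg fun i _ => Int.natCast_nonneg _
  omega

lemma layerSum_one_zero_pos {d : ℕ} (k : Fin d → ℕ) : 0 < layerSum k 1 0 := by
  refine Finset.sum_pos' (fun a _ => by split_ifs <;> simp) ⟨0, by simp [mem_Iic], ?_⟩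
  simp

lemma layerSum_eq_zero {d : ℕ} (k : Fin d → ℕ) (f : (Fin d → ℕ) → ℝ) {t : ℤ}
    (h : layerSum k 1 t = 0) : layerSum k f t = 0 := by
  rw [layerSum, Finset.sum_eq_zero_iff_of_nonneg (fun a _ => by split_ifs <;> simp)] at h
  refine Finset.sum_eq_zero fun a ha => if_neg fun hat => ?_
  simpa [hat] using h a ha

lemma layerSum_eq_mul_layerMean {d : ℕ} (k : Fin d → ℕ) (f : (Fin d → ℕ) → ℝ) (t : ℤ) :
    layerSum k f t = layerSum k 1 t * layerMean k f t := by
  rcases lt_or_ge t 0 with ht | ht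
  · simp [layerSum_of_neg _ _ ht]
  · rw [layerMean, max_eq_left ht]
    by_cases h : layerSum k 1 t = 0
    · rw [h, layerSum_eq_zero k f h]; simp
    · field_simp

lemma layerMean_nonneg {d : ℕ} (k : Fin d → ℕ) {f : (Fin d → ℕ) → ℝ} (h : 0 ≤ f) (t : ℤ) :
    0 ≤ layerMean k f t :=
  div_nonneg (layerSum_nonneg k h _) (layerSum_one_nonneg k _)

lemma layerMean_mono {d : ℕ} (k : Fin d → ℕ) {f g : (Fin d → ℕ) → ℝ} (h : f ≤ g) (t : ℤ) :
    layerMean k f t ≤ layerMean k g t :=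
  div_le_div_of_nonneg_right (layerSum_mono k h _) (layerSum_one_nonneg k _)

/-- Log-concavity of a sequence is preserved by taking sums over a sliding window. -/
lemma IsLogConcaveSeq.window {w : ℤ → ℝ} (hw : IsLogConcaveSeq w) (k : ℕ) :
    IsLogConcaveSeq (fun t => ∑ x ∈ range (k + 1), w (t - x)) := by
  set W : ℤ → ℝ := fun t => ∑ x ∈ range (k + 1), w (t - x) with hW
  have shift : ∀ t, W (t + 1) = W t + w (t + 1) - w (t - k) := by
    intro t
    simp only [hW]
    rw [Finset.sum_range_succ' _ k, Finset.sum_range_succ _ k]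
    simp only [Nat.cast_add, Nat.cast_one, add_sub_add_right_eq_sub, Nat.cast_zero, sub_zero]
    ring
  have step : ∀ p q, p ≤ q → W p * W (q + 1) ≤ W (p + 1) * W q := by
    intro p q hpq
    have upper : W p * w (q + 1) ≤ w (p + 1) * W q := by
      simp only [hW, Finset.sum_mul, Finset.mul_sum]
      refine Finset.sum_le_sum fun x _ => ?_
      have := hw (p - x) (q - x) (x + 1) (by omega)
      push_cast at this
      rwa [show p - x + ((x : ℤ) + 1) = p + 1 by ring,
        show q - x + ((x : ℤ) + 1) = q + 1 by ring] at this
    have lower : w (p - k) * W q ≤ W p * w (q - k) := by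
      simp only [hW, Finset.sum_mul, Finset.mul_sum]
      refine Finset.sum_le_sum fun x hx => ?_
      have hxk : x ≤ k := Nat.le_of_lt_succ (mem_range.1 hx)
      have := hw (p - k) (q - k) (k - x) (by omega)
      push_cast [hxk] at this
      rwa [show p - k + ((k : ℤ) - x) = p - x by ring,
        show q - k + ((k : ℤ) - x) = q - x by ring] at this
    rw [shift, shift]
    linarith
  intro p q n
  induction n generalizing p with
  | zero => intro _; simp
  | succ n ih =>
    intro hpq
    rcases hpq.eq_or_lt with rfl | hlt
    · exact (mul_comm _ _).le
    · have h₁ := step p (q + n) (by omega)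
      have h₂ := ih (p + 1) (by omega)
      push_cast
      rw [← add_assoc, show p + ((n : ℤ) + 1) = p + 1 + n by ring]
      exact h₁.trans h₂

lemma isLogConcaveSeq_layerSum_one {d : ℕ} (k : Fin d → ℕ) :
    IsLogConcaveSeq (layerSum k 1) := by
  induction d with
  | zero =>
    intro p q n hpq
    rcases eq_or_ne p q with rfl | hne
    · exact (mul_comm _ _).le
    have : layerSum k 1 p * layerSum k 1 (q + n) = 0 := by
      simp only [layerSum, Finset.univ_eq_empty, Finset.sum_empty]
      rcases eq_or_ne 0 p with rfl | hp
      · simp [show (0 : ℤ) ≠ q + n by omega]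
      · simp [hp]
    rw [this]
    exact mul_nonneg (layerSum_one_nonneg _ _) (layerSum_one_nonneg _ _)
  | succ d ih =>
    have : layerSum k 1 = fun t => ∑ x ∈ range (k 0 + 1), layerSum (Fin.tail k) 1 (t - x) := by
      funext t
      exact layerSum_succ k 1 t
    rw [this]
    exact (ih (Fin.tail k)).window (k 0)

/-- A weighted comparison of two interlacing families `H x, H (x + 1) ≤ G x`, for weights whose
partial sums interlace as well. -/
lemma sum_mul_le_of_interlacing {n : ℕ} {p q G H : ℕ → ℝ}
    (hHG : ∀ x, H x ≤ G x) (hHG' : ∀ x, H (x + 1) ≤ G x)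
    (hpq : ∀ c ≤ n, (∑ x ∈ range n, p x) * ∑ x ∈ range c, q x
      ≤ (∑ x ∈ range n, q x) * ∑ x ∈ range c, p x)
    (hqp : ∀ c < n, (∑ x ∈ range n, q x) * ∑ x ∈ range c, p x
      ≤ (∑ x ∈ range n, p x) * ∑ x ∈ range (c + 1), q x) :
    (∑ x ∈ range n, p x) * ∑ x ∈ range n, q x * H x
      ≤ (∑ x ∈ range n, q x) * ∑ x ∈ range n, p x * G x := by
  set P := ∑ x ∈ range n, p x with hP
  set Q := ∑ x ∈ range n, q x with hQ
  have key : ∀ c ≤ n, (Q * ∑ x ∈ range c, p x - P * ∑ x ∈ range c, q x) * H c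
      ≤ Q * (∑ x ∈ range c, p x * G x) - P * ∑ x ∈ range c, q x * H x := by
    intro c
    induction c with
    | zero => simp
    | succ c ih =>
      intro hc
      have h₁ := ih (by omega)
      have h₂ := hpq (c + 1) hc
      have h₃ := hqp c (by omega)
      simp only [Finset.sum_range_succ] at h₂ h₃ ⊢
      have h₄ := mul_nonneg (sub_nonneg.2 h₂) (sub_nonneg.2 (hHG' c))
      have h₅ := mul_nonneg (sub_nonneg.2 h₃) (sub_nonneg.2 (hHG c))
      linarith
  have h := key n le_rfl
  rw [← hP, ← hQ, mul_comm Q P, sub_self, zero_mul] at h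
  linarith

lemma sum_range_mul_sum_range_le {n c : ℕ} (hc : c ≤ n) {p q : ℕ → ℝ}
    (h : ∀ x y, x ≤ y → q x * p y ≤ p x * q y) :
    (∑ x ∈ range n, p x) * ∑ x ∈ range c, q x
      ≤ (∑ x ∈ range n, q x) * ∑ x ∈ range c, p x := by
  rw [← Finset.sum_range_add_sum_Ico p hc, ← Finset.sum_range_add_sum_Ico q hc, add_mul, add_mul,
    mul_comm (∑ x ∈ range c, p x)]
  refine add_le_add le_rfl ?_
  rw [Finset.sum_mul_sum, Finset.sum_mul_sum]
  refine Finset.sum_le_sum fun y hy => Finset.sum_le_sum fun x hx => ?_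
  rw [mul_comm, mul_comm (q y)]
  exact h x y ((mem_range.1 hx).le.trans (mem_Ico.1 hy).1)

/-- Monotonicity of the mean values over layers, expressed through the layer sums. -/
lemma layerMean_antitone_of_mul_le {d : ℕ} (k : Fin d → ℕ) {f : (Fin d → ℕ) → ℝ} (hf : 0 ≤ f)
    (h : ∀ t : ℤ, 0 ≤ t →
      layerSum k 1 t * layerSum k f (t + 1) ≤ layerSum k 1 (t + 1) * layerSum k f t) :
    Antitone (layerMean k f) := by
  refine antitone_int_of_succ_le fun t => ?_
  rcases lt_or_ge t 0 with ht | ht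
  · rw [layerMean, layerMean, max_eq_right (by omega : t + 1 ≤ 0), max_eq_right ht.le]
  rcases (layerSum_one_nonneg k (t + 1)).eq_or_lt with h₁ | h₁
  · have : layerMean k f (t + 1) = 0 := by
      rw [layerMean, max_eq_left (by omega : 0 ≤ t + 1), ← h₁, div_zero]
    rw [this]
    exact layerMean_nonneg k hf t
  · have h₀ : 0 < layerSum k 1 t := by
      refine (layerSum_one_nonneg k t).lt_of_ne fun h₀ => ?_
      have := isLogConcaveSeq_layerSum_one k 0 t 1 ht
      rw [← h₀, mul_zero] at this
      exact absurd (mul_pos (layerSum_one_zero_pos k) h₁) this.not_gt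
    rw [layerMean, layerMean, max_eq_left ht, max_eq_left (by omega : 0 ≤ t + 1),
      div_le_div_iff₀ h₁ h₀]
    linarith [h t ht]

/-- The mean value of an antitone function over the layers of a box decreases with the level. -/
theorem layerMean_antitone {d : ℕ} (k : Fin d → ℕ) {f : (Fin d → ℕ) → ℝ} (hf : 0 ≤ f)
    (hanti : Antitone f) : Antitone (layerMean k f) := by
  induction d with
  | zero =>
    refine layerMean_antitone_of_mul_le k hf fun t ht => ?_
    have : layerSum k f (t + 1) = 0 := by
      simp [layerSum, show (0 : ℤ) ≠ t + 1 by omega]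
    rw [this, mul_zero]
    exact mul_nonneg (layerSum_one_nonneg _ _) (layerSum_nonneg _ hf _)
  | succ d ih =>
    refine layerMean_antitone_of_mul_le k hf fun s _ => ?_
    set w := layerSum (Fin.tail k) 1 with hw
    have hlc : IsLogConcaveSeq w := isLogConcaveSeq_layerSum_one _
    have hone : ∀ t, layerSum k 1 t = ∑ x ∈ range (k 0 + 1), w (t - x) := layerSum_succ k 1
    have hsum : ∀ t, layerSum k f t = ∑ x ∈ range (k 0 + 1),
        w (t - x) * layerMean (Fin.tail k) (fun b => f (Fin.cons x b)) (t - x) := by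
      intro t
      rw [layerSum_succ]
      exact Finset.sum_congr rfl fun x _ => layerSum_eq_mul_layerMean _ _ _
    have hmean : ∀ x : ℕ, Antitone (layerMean (Fin.tail k) (fun b => f (Fin.cons x b))) :=
      fun x => ih (Fin.tail k) (fun b => hf _)
        fun b c hbc => hanti (Fin.cons_le_cons.2 ⟨le_rfl, hbc⟩)
    rw [hone, hone, hsum, hsum]
    refine sum_mul_le_of_interlacing (fun x => hmean x (by omega)) (fun x => ?_) ?_ ?_
    · push_cast
      rw [show s + 1 - ((x : ℤ) + 1) = s - x by ring]
      exact layerMean_mono _ (fun b => hanti (Fin.cons_le_cons.2 ⟨x.le_succ, le_rfl⟩)) _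
    · intro c hc
      refine sum_range_mul_sum_range_le hc fun x y hxy => ?_
      have := hlc (s - y) (s - x) 1 (by omega)
      rw [Nat.cast_one, show s - (y : ℤ) + 1 = s + 1 - y by ring,
        show s - (x : ℤ) + 1 = s + 1 - x by ring] at this
      linarith
    · intro c hc
      have hnn : ∀ t, 0 ≤ w t := layerSum_one_nonneg _
      have hshift : ∀ n : ℕ, ∑ x ∈ range (n + 1), w (s + 1 - x)
          = ∑ x ∈ range n, w (s - x) + w (s + 1) := by
        intro n
        simp [Finset.sum_range_succ']
      have hle : ∑ x ∈ range c, w (s - x) ≤ ∑ x ∈ range (k 0 + 1), w (s - x) :=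
        Finset.sum_le_sum_of_subset_of_nonneg (range_mono hc.le) fun _ _ _ => hnn _
      have hC : 0 ≤ ∑ x ∈ range c, w (s - x) := Finset.sum_nonneg fun _ _ => hnn _
      have h₁ := mul_nonneg (hnn (s + 1)) (sub_nonneg.2 hle)
      have h₂ := mul_nonneg (hnn (s - k 0)) hC
      rw [hshift, hshift]
      rw [Finset.sum_range_succ] at h₁ ⊢
      linarith

lemma sum_layerSum {d : ℕ} (k : Fin d → ℕ) (f : (Fin d → ℕ) → ℝ) (m n : ℕ) :
    ∑ t ∈ Icc m n, layerSum k f t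
      = ∑ a ∈ Iic k with m ≤ ∑ i, a i ∧ ∑ i, a i ≤ n, f a := by
  simp only [layerSum]
  rw [Finset.sum_comm, Finset.sum_filter]
  refine Finset.sum_congr rfl fun a _ => ?_
  rw [← Nat.cast_sum]
  simp only [Nat.cast_inj, Finset.sum_ite_eq, mem_Icc]

/-- The proportion of a lower set within the levels `1, …, l` of a box decreases with `l`. -/
theorem card_mul_card_le_of_isLowerSet {d : ℕ} (k : Fin d → ℕ) {D : Finset (Fin d → ℕ)}
    (hD : IsLowerSet (D : Set (Fin d → ℕ))) {l l' : ℕ} (hl : l ≤ l') :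
    #{a ∈ Iic k | 1 ≤ ∑ i, a i ∧ ∑ i, a i ≤ l}
        * #{a ∈ {a ∈ Iic k | 1 ≤ ∑ i, a i ∧ ∑ i, a i ≤ l'} | a ∈ D}
      ≤ #{a ∈ {a ∈ Iic k | 1 ≤ ∑ i, a i ∧ ∑ i, a i ≤ l} | a ∈ D}
        * #{a ∈ Iic k | 1 ≤ ∑ i, a i ∧ ∑ i, a i ≤ l'} := by
  set f : (Fin d → ℕ) → ℝ := fun a => if a ∈ D then 1 else 0 with hf
  have hf0 : 0 ≤ f := fun a => by simp only [hf]; split_ifs <;> simp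
  have hanti : Antitone f := by
    intro a b hab
    simp only [hf]
    split_ifs with hb ha ha
    · exact le_rfl
    · exact absurd (hD hab hb) ha
    · exact zero_le_one
    · exact le_rfl
  have hmean := layerMean_antitone k hf0 hanti
  have hone : ∀ n : ℕ, (#{a ∈ Iic k | 1 ≤ ∑ i, a i ∧ ∑ i, a i ≤ n} : ℝ)
      = ∑ t ∈ Icc 1 n, layerSum k 1 t := by
    intro n
    rw [sum_layerSum]
    simp
  have hcard : ∀ n : ℕ, (#{a ∈ {a ∈ Iic k | 1 ≤ ∑ i, a i ∧ ∑ i, a i ≤ n} | a ∈ D} : ℝ)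
      = ∑ t ∈ Icc 1 n, layerSum k f t := by
    intro n
    rw [sum_layerSum]
    simp [hf, Finset.filter_mem_eq_inter]
  have hsplit : ∀ g : ℕ → ℝ, ∑ t ∈ Icc 1 l', g t = ∑ t ∈ Icc 1 l, g t + ∑ t ∈ Ioc l l', g t := by
    intro g
    rw [← Finset.sum_union]
    · congr 1
      ext t
      simp only [mem_Icc, mem_union, mem_Ioc]
      omega
    · rw [Finset.disjoint_left]
      intro t
      simp only [mem_Icc, mem_Ioc]
      omega
  rw [← Nat.cast_le (α := ℝ)]
  push_cast
  rw [hone, hone, hcard, hcard, hsplit, hsplit]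
  have low : (∑ t ∈ Icc 1 l, layerSum k 1 t) * layerMean k f l
      ≤ ∑ t ∈ Icc 1 l, layerSum k f t := by
    rw [Finset.sum_mul]
    refine Finset.sum_le_sum fun t ht => ?_
    rw [layerSum_eq_mul_layerMean k f]
    exact mul_le_mul_of_nonneg_left (hmean (by exact_mod_cast (mem_Icc.1 ht).2))
      (layerSum_one_nonneg _ _)
  have high : ∑ t ∈ Ioc l l', layerSum k f t
      ≤ (∑ t ∈ Ioc l l', layerSum k 1 t) * layerMean k f l := by
    rw [Finset.sum_mul]
    refine Finset.sum_le_sum fun t ht => ?_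
    rw [layerSum_eq_mul_layerMean k f]
    exact mul_le_mul_of_nonneg_left (hmean (by exact_mod_cast (mem_Ioc.1 ht).1.le))
      (layerSum_one_nonneg _ _)
  have h₁ := mul_le_mul_of_nonneg_left high
    (Finset.sum_nonneg fun (t : ℕ) (_ : t ∈ Icc 1 l) => layerSum_one_nonneg k t)
  have h₂ := mul_le_mul_of_nonneg_left low
    (Finset.sum_nonneg fun (t : ℕ) (_ : t ∈ Ioc l l') => layerSum_one_nonneg k t)
  linarith

section NewVectors

variable {ι K V : Type*} [LinearOrder ι] [Field K] [AddCommGroup V] [Module K V]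

/-- Vectors that do not lie in the span of their predecessors are linearly independent. -/
lemma linearIndependent_of_notMem_span_image_Iio {v : ι → V} {D : Set ι}
    (hD : ∀ i ∈ D, v i ∉ Submodule.span K (v '' Set.Iio i)) :
    LinearIndependent K (fun i : D => v i) := by
  classical
  rw [linearIndependent_iff']
  intro s g hg
  by_contra! hne
  obtain ⟨i₀, hi₀, hgi₀⟩ := hne
  have hT : (s.filter fun i => g i ≠ 0).Nonempty := ⟨i₀, by simp [hi₀, hgi₀]⟩
  obtain ⟨m, hm, hmax⟩ := Finset.exists_max_image _ id hT
  rw [mem_filter] at hm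
  refine hD m m.2 ?_
  rw [← Finset.add_sum_erase s _ hm.1] at hg
  rw [← Submodule.smul_mem_iff _ hm.2, eq_neg_of_add_eq_zero_left hg]
  refine Submodule.neg_mem _ (Submodule.sum_mem _ fun i hi => ?_)
  rw [mem_erase] at hi
  by_cases hgi : g i = 0
  · simp [hgi]
  · refine Submodule.smul_mem _ _ (Submodule.subset_span ⟨i, ?_, rfl⟩)
    exact lt_of_le_of_ne (hmax i (by simp [hi.2, hgi])) fun h => hi.1 (Subtype.ext h)

/-- Vectors that do not lie in the span of their predecessors span everything. -/
lemma mem_span_image_setOf_notMem_span [WellFoundedLT ι] (v : ι → V) (i : ι) :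
    v i ∈ Submodule.span K (v '' {i | v i ∉ Submodule.span K (v '' Set.Iio i)}) := by
  induction i using WellFoundedLT.induction with
  | ind i ih =>
    by_cases hi : v i ∈ Submodule.span K (v '' Set.Iio i)
    · refine Submodule.span_le.2 ?_ hi
      rintro _ ⟨j, hj, rfl⟩
      exact ih j hj
    · exact Submodule.subset_span ⟨i, hi, rfl⟩

end NewVectors

/-- The values of the monomial with exponent `i` at the points of `B`. -/
def monomialValues {d : ℕ} (B : Finset (Fin d → ℕ)) (i : Fin d → ℕ) : B → ℝ :=
  fun a => ∏ m, ((a : Fin d → ℕ) m : ℝ) ^ i m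

lemma monomialValues_add {d : ℕ} (B : Finset (Fin d → ℕ)) (i j : Fin d → ℕ) :
    monomialValues B (i + j) = monomialValues B i * monomialValues B j := by
  funext a
  simp [monomialValues, pow_add, Finset.prod_mul_distrib]

/-- Evaluation of monomials at a point, as a character of the monoid of exponents. -/
def evalChar {d : ℕ} (a : Fin d → ℕ) : Multiplicative (Fin d → ℕ) →* ℝ where
  toFun i := ∏ m, (a m : ℝ) ^ (i.toAdd m)
  map_one' := by simp
  map_mul' i j := by simp [pow_add, Finset.prod_mul_distrib]

lemma evalChar_injective {d : ℕ} :
    Function.Injective (evalChar : (Fin d → ℕ) → (Multiplicative (Fin d → ℕ) →* ℝ)) := by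
  intro a b h
  funext m
  have hm := DFunLike.congr_fun h (Multiplicative.ofAdd (Pi.single m 1))
  have key : ∀ c : Fin d → ℕ, evalChar c (Multiplicative.ofAdd (Pi.single m 1)) = c m := by
    intro c
    simp only [evalChar, MonoidHom.coe_mk, OneHom.coe_mk, toAdd_ofAdd]
    rw [Finset.prod_eq_single m (fun n _ hn => by simp [hn]) (by simp)]
    simp
  rw [key, key] at hm
  exact_mod_cast hm

lemma span_range_monomialValues {d : ℕ} (B : Finset (Fin d → ℕ)) :
    Submodule.span ℝ (Set.range (monomialValues B)) = ⊤ := by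
  classical
  by_contra hne
  obtain ⟨φ, hφ, hker⟩ := Submodule.exists_le_ker_of_lt_top _ (lt_top_iff_ne_top.2 hne)
  have hind := (linearIndependent_monoidHom (Multiplicative (Fin d → ℕ)) ℝ).comp
    (fun a : B => evalChar (a : Fin d → ℕ)) (evalChar_injective.comp Subtype.val_injective)
  rw [Fintype.linearIndependent_iff] at hind
  have hzero := hind (fun a => φ (Pi.single a 1)) (by
    funext i
    have := hker (Submodule.subset_span ⟨i.toAdd, rfl⟩)
    rw [LinearMap.mem_ker, LinearMap.pi_apply_eq_sum_univ φ] at this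
    simp only [Finset.sum_apply, Pi.smul_apply, Function.comp_apply, Pi.zero_apply]
    rw [← this]
    refine Finset.sum_congr rfl fun a _ => ?_
    rw [smul_eq_mul, smul_eq_mul, mul_comm]
    congr 2
    funext b
    simp [Pi.single_apply, eq_comm])
  exact hφ (LinearMap.pi_ext' fun a => LinearMap.ext_ring (hzero a))

/-- If no point of `B` dominates `i`, the monomial with exponent `i` agrees on `B` with a
combination of its proper divisors. -/
lemma monomialValues_mem_span_Iio {d : ℕ} {B : Finset (Fin d → ℕ)} {i : Fin d → ℕ}
    (hi : ∀ a ∈ B, ¬ i ≤ a) :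
    monomialValues B i ∈ Submodule.span ℝ (monomialValues B '' Set.Iio i) := by
  set c : (Fin d → ℕ) → ℝ := fun j => ∏ m, (descPochhammer ℝ (i m)).coeff (j m) with hc
  have hci : c i = 1 := by
    refine Finset.prod_eq_one fun m _ => ?_
    have := (monic_descPochhammer ℝ (i m)).coeff_natDegree
    rwa [descPochhammer_natDegree] at this
  have hmem : i ∈ Fintype.piFinset fun m => range (i m + 1) := by simp
  have hsum : ∑ j ∈ Fintype.piFinset fun m => range (i m + 1), c j • monomialValues B j = 0 := by
    funext a
    have hprod : ∏ m, (descPochhammer ℝ (i m)).eval ((a : Fin d → ℕ) m : ℝ) = 0 := by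
      have := hi a a.2
      rw [Pi.le_def] at this
      push Not at this
      obtain ⟨m, hm⟩ := this
      refine Finset.prod_eq_zero (mem_univ m) ?_
      rw [descPochhammer_eval_eq_descFactorial, Nat.descFactorial_eq_zero_iff_lt.2 hm, Nat.cast_zero]
    simp only [Polynomial.eval_eq_sum_range, descPochhammer_natDegree, Finset.prod_univ_sum,
      Finset.prod_mul_distrib] at hprod
    simpa [monomialValues, hc] using hprod
  rw [← Finset.add_sum_erase _ _ hmem, hci, one_smul] at hsum
  rw [eq_neg_of_add_eq_zero_left hsum]
  refine Submodule.neg_mem _ (Submodule.sum_mem _ fun j hj => Submodule.smul_mem _ _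
    (Submodule.subset_span ⟨j, ?_, rfl⟩))
  rw [mem_erase, Fintype.mem_piFinset] at hj
  exact lt_of_le_of_ne (fun m => Nat.le_of_lt_succ (mem_range.1 (hj.2 m))) hj.1

/-- Any finite set `B` of points inside a finite lower set `L` admits a lower set `D ⊆ L` of
exponents, of the same size as `B`, whose monomials are linearly independent on `B`. -/
theorem exists_isLowerSet_linearIndependent_monomialValues {d : ℕ} {B L : Finset (Fin d → ℕ)}
    (hL : IsLowerSet (L : Set (Fin d → ℕ))) (hBL : B ⊆ L) :
    ∃ D ⊆ L, IsLowerSet (D : Set (Fin d → ℕ)) ∧ #D = #B ∧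
      LinearIndependent ℝ (fun i : D => monomialValues B i) := by
  classical
  let v : Lex (Fin d → ℕ) → (B → ℝ) := fun i => monomialValues B (ofLex i)
  let S : Set (Lex (Fin d → ℕ)) := {i | v i ∉ Submodule.span ℝ (v '' Set.Iio i)}
  have hSL : ∀ i : Fin d → ℕ, toLex i ∈ S → i ∈ L := by
    intro i hi
    by_contra hiL
    refine hi (Submodule.span_mono ?_ (monomialValues_mem_span_Iio
      fun a ha hia => hiL (hL hia (hBL ha))))
    rintro _ ⟨j, hj, rfl⟩
    exact ⟨toLex j, Pi.toLex_strictMono hj, rfl⟩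
  have hlower : ∀ i j : Fin d → ℕ, j ≤ i → toLex i ∈ S → toLex j ∈ S := by
    intro i j hji hi hj
    obtain ⟨u, rfl⟩ := exists_add_of_le hji
    refine hi ?_
    have hmap := Submodule.mem_map_of_mem (f := LinearMap.mulRight ℝ (monomialValues B u)) hj
    rw [Submodule.map_span] at hmap
    have heq : v (toLex (j + u)) = LinearMap.mulRight ℝ (monomialValues B u) (v (toLex j)) :=
      monomialValues_add B j u
    rw [heq]
    refine Submodule.span_mono ?_ hmap
    rintro _ ⟨_, ⟨p, hp, rfl⟩, rfl⟩
    exact ⟨p + toLex u, add_lt_add_left hp (toLex u), monomialValues_add B (ofLex p) u⟩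
  let D : Finset (Fin d → ℕ) := L.filter fun i => toLex i ∈ S
  have hD : ∀ i, i ∈ D ↔ toLex i ∈ S := fun i => by
    simp only [D, mem_filter, and_iff_right_iff_imp]
    exact hSL i
  have hind : LinearIndependent ℝ (fun i : D => monomialValues B i) :=
    (linearIndependent_of_notMem_span_image_Iio (v := v) (D := S) fun _ h => h).comp
      (fun i : D => (⟨toLex (i : Fin d → ℕ), (hD i).1 i.2⟩ : S))
      fun i j h => Subtype.ext (toLex.injective (Subtype.mk.inj h))
  refine ⟨D, filter_subset _ _, ?_, ?_, hind⟩
  · intro i j hji hi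
    exact (hD j).2 (hlower i j hji ((hD i).1 hi))
  · have hspan : Submodule.span ℝ (Set.range fun i : D => monomialValues B i) = ⊤ := by
      rw [← top_le_iff, ← span_range_monomialValues B, Submodule.span_le]
      rintro _ ⟨i, rfl⟩
      refine Submodule.span_mono ?_ (mem_span_image_setOf_notMem_span (K := ℝ) v (toLex i))
      rintro _ ⟨j, hj, rfl⟩
      exact ⟨⟨ofLex j, (hD _).2 hj⟩, rfl⟩
    have := Module.finrank_eq_card_basis (Module.Basis.mk hind hspan.ge)
    simpa using this.symm

/-- Vandermonde-type rank estimate: for `𝒜 ⊆ 𝒮^𝐤_{l'}`, the real rank of the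
matrix `(𝐚^𝐢)_{𝐚∈𝒜, 𝐢∈𝒮^𝐤_l}` is at least `(|𝒮^𝐤_l| / |𝒮^𝐤_{l'}|) · |𝒜|`. -/
theorem stmt8 (d : ℕ) (hd : 1 ≤ d) (k : Fin d → ℕ) (hk : ∀ i, 0 < k i)
    (l l' : ℕ) (hl : 1 ≤ l) (hll' : l < l')
    (A : Finset (Fin d → ℕ))
    (hA : A ⊆ (Finset.Iic k).filter (fun a : Fin d → ℕ => 1 ≤ ∑ i, a i ∧ (∑ i, a i) ≤ l')) :
    ((((Finset.Iic k).filter (fun a : Fin d → ℕ => 1 ≤ ∑ i, a i ∧ (∑ i, a i) ≤ l)).card : ℝ)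
        / (((Finset.Iic k).filter (fun a : Fin d → ℕ => 1 ≤ ∑ i, a i ∧ (∑ i, a i) ≤ l')).card : ℝ))
      * (A.card : ℝ)
    ≤ (Matrix.rank (fun (a : ↥A)
        (i : ↥((Finset.Iic k).filter (fun a : Fin d → ℕ => 1 ≤ ∑ j, a j ∧ (∑ j, a j) ≤ l))) =>
          ∏ m, (((a : Fin d → ℕ) m : ℝ)) ^ ((i : Fin d → ℕ) m)) : ℝ) := by
  set S : ℕ → Finset (Fin d → ℕ) :=
    fun n => (Finset.Iic k).filter (fun a : Fin d → ℕ => 1 ≤ ∑ i, a i ∧ (∑ i, a i) ≤ n) with hS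
  have hmemS : ∀ n a, a ∈ S n ↔ a ≤ k ∧ 1 ≤ ∑ i, a i ∧ ∑ i, a i ≤ n := by simp [hS]
  have hzero : ∀ n, (0 : Fin d → ℕ) ∉ S n := by simp [hmemS]
  set L : Finset (Fin d → ℕ) := {a ∈ Iic k | ∑ i, a i ≤ l'} with hL
  have hmemL : ∀ a, a ∈ L ↔ a ≤ k ∧ ∑ i, a i ≤ l' := by simp [hL]
  have hLlower : IsLowerSet (L : Set (Fin d → ℕ)) := by
    intro a b hba ha
    rw [mem_coe, hmemL] at ha ⊢
    exact ⟨hba.trans ha.1, (Finset.sum_le_sum fun i _ => hba i).trans ha.2⟩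
  have hBL : insert 0 A ⊆ L := by
    refine insert_subset (by simp [hmemL]) fun a ha => ?_
    have := (hmemS l' a).1 (hA ha)
    exact (hmemL a).2 ⟨this.1, this.2.2⟩
  obtain ⟨D, hDL, hDlower, hDcard, hind⟩ :=
    exists_isLowerSet_linearIndependent_monomialValues hLlower hBL
  rw [card_insert_of_notMem fun h => hzero l' (hA h)] at hDcard
  have hD0 : 0 ∈ D := by
    obtain ⟨a, ha⟩ : D.Nonempty := card_pos.1 (by omega)
    exact hDlower (fun _ => Nat.zero_le _) ha
  have hDA : #{a ∈ S l' | a ∈ D} = #A := by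
    have : {a ∈ S l' | a ∈ D} = D.erase 0 := by
      ext a
      rw [mem_filter, mem_erase, hmemS]
      constructor
      · rintro ⟨⟨_, h, _⟩, haD⟩
        exact ⟨fun h0 => by simp [h0] at h, haD⟩
      · rintro ⟨h0, haD⟩
        have haL := (hmemL a).1 (hDL haD)
        refine ⟨⟨haL.1, Nat.one_le_iff_ne_zero.2 fun hs => h0 ?_, haL.2⟩, haD⟩
        funext i
        exact Finset.sum_eq_zero_iff.1 hs i (mem_univ i)
    rw [this, card_erase_of_mem hD0, hDcard, Nat.add_sub_cancel]
  have hrank : #{a ∈ S l | a ∈ D} ≤ Matrix.rank (fun (a : A) (i : S l) =>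
      ∏ m, ((a : Fin d → ℕ) m : ℝ) ^ (i : Fin d → ℕ) m) := by
    set M : Matrix A (S l) ℝ := fun a i => ∏ m, ((a : Fin d → ℕ) m : ℝ) ^ (i : Fin d → ℕ) m with hM
    let incl : {x // x ∈ {a ∈ S l | a ∈ D}} → S l := fun i => ⟨i, (mem_filter.1 i.2).1⟩
    have hrows : LinearIndependent ℝ (M.submatrix id incl).transpose.row := by
      rw [Fintype.linearIndependent_iff]
      intro g hg
      refine Fintype.linearIndependent_iff.1 (hind.comp
        (fun i : {x // x ∈ {a ∈ S l | a ∈ D}} => (⟨i, (mem_filter.1 i.2).2⟩ : D))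
        fun i j h => Subtype.ext (congrArg Subtype.val h :)) g ?_
      funext ⟨a, ha⟩
      rcases mem_insert.1 ha with rfl | haA
      · simp only [Finset.sum_apply, Pi.smul_apply, Function.comp_apply, Pi.zero_apply]
        refine Finset.sum_eq_zero fun i _ => ?_
        have hi := (hmemS l i).1 (mem_filter.1 i.2).1
        obtain ⟨m, hm⟩ : ∃ m, (i : Fin d → ℕ) m ≠ 0 := by
          by_contra! hall
          simp [hall] at hi
        rw [smul_eq_mul, monomialValues, Finset.prod_eq_zero (mem_univ m) (by simp [hm]), mul_zero]
      · have := congrFun hg ⟨a, haA⟩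
        simp only [Finset.sum_apply, Pi.smul_apply, Function.comp_apply, Pi.zero_apply] at this ⊢
        exact this
    have h := hrows.rank_matrix
    rw [Matrix.rank_transpose, Fintype.card_coe] at h
    rw [← h]
    exact M.rank_submatrix_le id incl
  have hmain := card_mul_card_le_of_isLowerSet k hDlower hll'.le
  rw [hDA] at hmain
  have hmain' : (#(S l) : ℝ) * #A ≤ #{a ∈ S l | a ∈ D} * #(S l') := by exact_mod_cast hmain
  refine le_trans ?_ (Nat.cast_le.2 hrank)
  rw [div_mul_eq_mul_div]
  exact div_le_of_le_mul₀ (Nat.cast_nonneg _) (Nat.cast_nonneg _) hmain'
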